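/- Let f : ℂ → ℂ be a nonconstant entire function and let X ⊆ ℂ be a set with f(X) ⊆ X such that no connected component of X is bounded. Suppose there is a nonempty bounded open connected set G ⊆ ℂ with ∂G ⊆ X on which f has the blowing-up property: for every compact set K ⊆ ℂ there exists N ∈ ℕ such that K ⊆ f^n(G) for all n ≥ N. Then X is a spider's web. -/

import Mathlib

/-- A set `E ⊆ ℂ` is a *spider's web* if `E` is connected and there is a sequence
`(Gₙ)` of bounded, open, connected, simply connected sets with `∂Gₙ ⊆ E`,
`Gₙ ⊆ Gₙ₊₁` for all `n`, and `⋃ₙ Gₙ = ℂ`. -/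
def SpidersWeb (E : Set ℂ) : Prop :=
  IsConnected E ∧
    ∃ G : ℕ → Set ℂ,
      (∀ n, Bornology.IsBounded (G n) ∧ IsOpen (G n) ∧ IsConnected (G n) ∧
        SimplyConnectedSpace (G n)) ∧
      (∀ n, frontier (G n) ⊆ E) ∧
      (∀ n, G n ⊆ G (n + 1)) ∧
      (⋃ n, G n) = Set.univ

section

open Set Topology

/-- The `op`-fold of the values of `g` on consecutive pairs of the sequence `a, l, b`. -/
def walkFold {V M : Type*} (op : M → M → M) (g : V → V → M) : V → List V → V → M
  | a, [], b => g a b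
  | a, x :: l, b => op (g a x) (walkFold op g x l b)

theorem walkFold_append_cons {V M : Type*} (op : M → M → M) [ha : Std.Associative op]
    (g : V → V → M) (a : V) (l₁ : List V) (x : V) (l₂ : List V) (b : V) :
    walkFold op g a (l₁ ++ x :: l₂) b = op (walkFold op g a l₁ x) (walkFold op g x l₂ b) := by
  induction l₁ generalizing a with
  | nil => rfl
  | cons y l ih => simp only [List.cons_append, walkFold, ih, ha.assoc]

theorem walkFold_congr {V M : Type*} {op : M → M → M} {E : V → V → Prop} {Q : V → Prop}
    {g h : V → V → M} (hgh : ∀ p q, E p q → Q p → Q q → g p q = h p q) {a b : V} {l : List V}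
    (hw : walkFold And E a l b) (ha : Q a) (hl : ∀ x ∈ l, Q x) (hb : Q b) :
    walkFold op g a l b = walkFold op h a l b := by
  induction l generalizing a with
  | nil => exact hgh _ _ hw ha hb
  | cons y l ih =>
    simp only [List.mem_cons, forall_eq_or_imp] at hl
    simp only [walkFold] at hw ⊢
    rw [hgh _ _ hw.1 ha hl.1, ih hw.2 hl.1 hl.2]

theorem walkFold_and_ends {V : Type*} {E : V → V → Prop} {R : V → Prop}
    (hE : ∀ p q, E p q → R p ∧ R q) {a b : V} {l : List V} (hw : walkFold And E a l b) :
    R a ∧ (∀ x ∈ l, R x) ∧ R b := by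
  induction l generalizing a with
  | nil => simpa using hE _ _ hw
  | cons y l ih =>
    simp only [walkFold] at hw
    have := ih hw.2
    simpa using ⟨(hE _ _ hw.1).1, ⟨this.1, this.2.1⟩, this.2.2⟩

theorem walkFold_const_zero {V M : Type*} [AddMonoid M] (a b : V) (l : List V) :
    walkFold (· + ·) (fun _ _ : V ↦ (0 : M)) a l b = 0 := by
  induction l generalizing a with
  | nil => rfl
  | cons y l ih => simp [walkFold, ih]

theorem walkFold_add_sub {V M : Type*} [AddCommGroup M] (g : V → V → M) (F : V → M)
    (a b : V) (l : List V) :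
    walkFold (· + ·) (fun p q ↦ g p q + (F q - F p)) a l b =
      walkFold (· + ·) g a l b + (F b - F a) := by
  induction l generalizing a with
  | nil => rfl
  | cons y l ih => simp only [walkFold, ih]; abel

/-- The point of the complex plane with given integer coordinates. -/
noncomputable def latticePt (p : ℤ × ℤ) : ℂ := ⟨p.1, p.2⟩

/-- The closed unit square with lower left corner `(i, j)`. -/
def latticeSquare (i j : ℤ) : Set ℂ := Icc (i : ℝ) (i + 1) ×ℂ Icc (j : ℝ) (j + 1)

theorem convex_latticeSquare (i j : ℤ) : Convex ℝ (latticeSquare i j) :=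
  ((convex_Icc _ _).linear_preimage Complex.reLm).inter ((convex_Icc _ _).linear_preimage Complex.imLm)

theorem mem_latticeSquare {i j : ℤ} {z : ℂ} : z ∈ latticeSquare i j ↔
    ((i : ℝ) ≤ z.re ∧ z.re ≤ i + 1) ∧ ((j : ℝ) ≤ z.im ∧ z.im ≤ j + 1) := by
  simp [latticeSquare, Complex.mem_reProdIm]

/-- A possibly degenerate edge of the integer lattice contained in `T`. -/
def LatticeEdge (T : Set ℂ) (p q : ℤ × ℤ) : Prop :=
  ((p.1 = q.1 ∧ p.2 ≤ q.2 + 1 ∧ q.2 ≤ p.2 + 1) ∨ (p.2 = q.2 ∧ p.1 ≤ q.1 + 1 ∧ q.1 ≤ p.1 + 1)) ∧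
    segment ℝ (latticePt p) (latticePt q) ⊆ T

/-- The signed number of times the step from `p` to `q` crosses the vertical ray going up from the
centre of the square with lower left corner `(i, j)`. -/
def rayCrossing (i j : ℤ) (p q : ℤ × ℤ) : ℤ :=
  if p.2 = q.2 ∧ j < p.2 then
    if p.1 = i ∧ q.1 = i + 1 then 1 else if p.1 = i + 1 ∧ q.1 = i then -1 else 0
  else 0

/-- The winding number of a closed lattice walk around the square with lower left corner `(i, j)`. -/
def latticeWinding (a : ℤ × ℤ) (l : List (ℤ × ℤ)) (i j : ℤ) : ℤ :=
  walkFold (· + ·) (rayCrossing i j) a l a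

section
variable {T : Set ℂ} {a : ℤ × ℤ} {l : List (ℤ × ℤ)}

theorem mem_segment_latticePt_vert {i j : ℤ} {z : ℂ} (h1 : z.re = i) (h2 : (j : ℝ) ≤ z.im)
    (h3 : z.im ≤ j + 1) : z ∈ segment ℝ (latticePt (i, j)) (latticePt (i, j + 1)) := by
  refine ⟨j + 1 - z.im, z.im - j, by linarith, by linarith, by ring, ?_⟩
  apply Complex.ext <;> simp [latticePt, h1] <;> ring

theorem mem_segment_latticePt_horiz {i j : ℤ} {z : ℂ} (h1 : z.im = j) (h2 : (i : ℝ) ≤ z.re)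
    (h3 : z.re ≤ i + 1) : z ∈ segment ℝ (latticePt (i, j)) (latticePt (i + 1, j)) := by
  refine ⟨i + 1 - z.re, z.re - i, by linarith, by linarith, by ring, ?_⟩
  apply Complex.ext <;> simp [latticePt, h1] <;> ring

theorem latticeWinding_down (hw : walkFold And (LatticeEdge T) a l a) {i j : ℤ} {z : ℂ}
    (hz : z ∉ T) (h1 : z.im = j) (h2 : (i : ℝ) ≤ z.re) (h3 : z.re ≤ i + 1) :
    latticeWinding a l i (j - 1) = latticeWinding a l i j := by
  refine walkFold_congr (Q := fun _ ↦ True) ?_ hw trivial (by simp) trivial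
  rintro ⟨x, y⟩ ⟨x', y'⟩ ⟨h, hT⟩ - -
  have hs := mem_segment_latticePt_horiz h1 h2 h3
  have e1 : ¬ (x = i ∧ x' = i + 1 ∧ y = j ∧ y' = j) := by
    rintro ⟨rfl, rfl, rfl, rfl⟩; exact hz (hT hs)
  have e2 : ¬ (x = i + 1 ∧ x' = i ∧ y = j ∧ y' = j) := by
    rintro ⟨rfl, rfl, rfl, rfl⟩; exact hz (hT (segment_symm ℝ (latticePt _) (latticePt _) ▸ hs))
  simp only [rayCrossing]
  split_ifs <;> simp at * <;> omega

theorem latticeWinding_left (hw : walkFold And (LatticeEdge T) a l a) {i j : ℤ} {z : ℂ}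
    (hz : z ∉ T) (h1 : z.re = i) (h2 : (j : ℝ) ≤ z.im) (h3 : z.im ≤ j + 1) :
    latticeWinding a l (i - 1) j = latticeWinding a l i j := by
  have key : latticeWinding a l (i - 1) j = walkFold (· + ·) (fun p q ↦ rayCrossing i j p q +
      ((fun r : ℤ × ℤ ↦ if r.1 = i ∧ j < r.2 then (1 : ℤ) else 0) q -
        (fun r : ℤ × ℤ ↦ if r.1 = i ∧ j < r.2 then (1 : ℤ) else 0) p)) a l a := by
    refine walkFold_congr (Q := fun _ ↦ True) ?_ hw trivial (by simp) trivial
    rintro ⟨x, y⟩ ⟨x', y'⟩ ⟨h, hT⟩ - -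
    have hs := mem_segment_latticePt_vert h1 h2 h3
    have e1 : ¬ (x = i ∧ x' = i ∧ y = j ∧ y' = j + 1) := by
      rintro ⟨rfl, rfl, rfl, rfl⟩; exact hz (hT hs)
    have e2 : ¬ (x = i ∧ x' = i ∧ y = j + 1 ∧ y' = j) := by
      rintro ⟨rfl, rfl, rfl, rfl⟩; exact hz (hT (segment_symm ℝ (latticePt _) (latticePt _) ▸ hs))
    simp only at h
    simp only [rayCrossing]
    split_ifs <;> omega
  rw [key, walkFold_add_sub]
  simp [latticeWinding]

theorem latticeWinding_eq_of_mem (hw : walkFold And (LatticeEdge T) a l a) {i j : ℤ} {z : ℂ}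
    (hz : z ∉ T) (h : z ∈ latticeSquare i j) :
    latticeWinding a l i j = latticeWinding a l ⌊z.re⌋ ⌊z.im⌋ := by
  obtain ⟨⟨h1, h2⟩, h3, h4⟩ := mem_latticeSquare.1 h
  have hx : latticeWinding a l i j = latticeWinding a l ⌊z.re⌋ j := by
    rcases h2.lt_or_eq with h2 | h2
    · rw [Int.floor_eq_iff.2 ⟨h1, h2⟩]
    · have := latticeWinding_left (i := i + 1) (j := j) hw hz (by simpa using h2) h3 h4
      rw [h2]
      simpa using this
  rw [hx]
  rcases h4.lt_or_eq with h4 | h4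
  · rw [Int.floor_eq_iff.2 ⟨h3, h4⟩]
  · have := latticeWinding_down (i := ⌊z.re⌋) (j := j + 1) hw hz (by simpa using h4)
      (Int.floor_le _) (Int.lt_floor_add_one _).le
    rw [h4]
    simpa using this

theorem latticeWinding_eq_zero (hTb : Bornology.IsBounded T) (hTc : IsPreconnected Tᶜ)
    (hw : walkFold And (LatticeEdge T) a l a) {i j : ℤ} {z : ℂ}
    (hz : z ∉ T) (h : z ∈ latticeSquare i j) : latticeWinding a l i j = 0 := by
  rw [latticeWinding_eq_of_mem hw hz h]
  obtain ⟨R, hR0, hR⟩ := hTb.exists_pos_norm_lt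
  set w : ℂ → ℤ := fun z ↦ latticeWinding a l ⌊z.re⌋ ⌊z.im⌋ with hwdef
  have hcont : ContinuousOn w Tᶜ := by
    intro z hz
    have hfl (x : ℝ) : ∀ᶠ y : ℝ in 𝓝 x, (⌊y⌋ : ℝ) ≤ x ∧ x ≤ ⌊y⌋ + 1 := by
      filter_upwards [Iio_mem_nhds (Int.lt_floor_add_one x),
        Ioi_mem_nhds (sub_lt_iff_lt_add.2 (Int.ceil_lt_add_one x))] with y hy1 hy2
      have h1 : ⌊y⌋ ≤ ⌊x⌋ := Int.lt_add_one_iff.1 (Int.floor_lt.2 (by exact_mod_cast hy1))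
      have h2 : ⌈x⌉ - 1 ≤ ⌊y⌋ := Int.le_floor.2 (by push_cast; exact (mem_Ioi.1 hy2).le)
      have h1' : (⌊y⌋ : ℝ) ≤ ⌊x⌋ := by exact_mod_cast h1
      have h2' : (⌈x⌉ : ℝ) - 1 ≤ ⌊y⌋ := by exact_mod_cast h2
      exact ⟨h1'.trans (Int.floor_le x), by linarith [Int.le_ceil x]⟩
    have hev : w =ᶠ[𝓝 z] fun _ ↦ w z := by
      filter_upwards [Complex.continuous_re.continuousAt.eventually (hfl z.re),
        Complex.continuous_im.continuousAt.eventually (hfl z.im)] with z' h1 h2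
      exact latticeWinding_eq_of_mem hw hz (mem_latticeSquare.2 ⟨h1, h2⟩)
    exact (continuousAt_const.congr hev.symm).continuousWithinAt
  set y : ℂ := ⟨0, R + 1⟩
  have hy : y ∉ T := fun h ↦ by
    have := (Complex.abs_im_le_norm y).trans_lt (hR _ h)
    have := (abs_lt.1 this).2
    simp [y] at this
    linarith
  refine (hTc.constant hcont hz hy).trans ?_
  obtain ⟨ha, hl, -⟩ := walkFold_and_ends (R := fun p ↦ p.2 ≤ ⌊y.im⌋) (fun p q h ↦ by
    have key (r : ℤ × ℤ) (hr : latticePt r ∈ T) : r.2 ≤ ⌊y.im⌋ := by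
      have := (abs_lt.1 ((Complex.abs_im_le_norm _).trans_lt (hR _ hr))).2
      refine Int.le_floor.2 ?_
      simp only [latticePt, y] at this ⊢
      linarith
    exact ⟨key p (h.2 (left_mem_segment ..)), key q (h.2 (right_mem_segment ..))⟩) hw
  refine (walkFold_congr (Q := fun p ↦ p.2 ≤ ⌊y.im⌋) ?_ hw ha hl ha).trans
    (walkFold_const_zero a a l)
  intro p q _ hp _
  simp only [rayCrossing]
  rw [if_neg (by omega)]

theorem exists_lex_max (a : ℤ × ℤ) (l : List (ℤ × ℤ)) :
    ∃ m ∈ a :: l, ∀ x ∈ a :: l, x.2 < m.2 ∨ x.2 = m.2 ∧ x.1 ≤ m.1 := by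
  obtain ⟨m, hm, h⟩ := Finset.exists_max_image (a :: l).toFinset
    (fun p ↦ toLex (p.2, p.1)) ⟨a, by simp⟩
  exact ⟨m, by simpa using hm, fun x hx ↦ by simpa [Prod.Lex.le_iff] using h x (by simpa using hx)⟩

theorem latticeWinding_corner_ne_zero {u v : ℤ × ℤ}
    (hw : walkFold And (LatticeEdge T) a (u :: (l ++ [v])) a)
    (hmax : ∀ x ∈ u :: (l ++ [v]), x.2 < a.2 ∨ x.2 = a.2 ∧ x.1 < a.1) (huv : u ≠ v) :
    latticeWinding a (u :: (l ++ [v])) (a.1 - 1) (a.2 - 1) ≠ 0 := by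
  have hw' := hw
  simp only [walkFold, walkFold_append_cons] at hw'
  obtain ⟨h1, h2, h3⟩ := hw'
  have hu := hmax u (by simp)
  have hv := hmax v (by simp)
  have hmid : walkFold (· + ·) (rayCrossing (a.1 - 1) (a.2 - 1)) u l v = 0 := by
    refine (walkFold_congr (Q := fun p ↦ p.2 < a.2 ∨ p.2 = a.2 ∧ p.1 < a.1) ?_ h2 hu
      (fun x hx ↦ hmax x (by simp [hx])) hv).trans (walkFold_const_zero u v l)
    intro p q _ hp hq
    simp only [rayCrossing]
    split_ifs <;> omega
  simp only [latticeWinding, walkFold, walkFold_append_cons, hmid]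
  obtain ⟨a1, a2⟩ := a
  obtain ⟨u1, u2⟩ := u
  obtain ⟨v1, v2⟩ := v
  have h1 := h1.1
  have h3 := h3.1
  simp only [ne_eq, Prod.mk.injEq] at h1 h3 hu hv huv
  simp only [rayCrossing]
  split_ifs <;> omega

/-- Products of a local cocycle along closed lattice walks are trivial. -/
theorem walkFold_lattice_eq_one (hTb : Bornology.IsBounded T) (hTc : IsPreconnected Tᶜ)
    {Γ : Type*} [Group Γ] {g : ℂ → ℂ → Γ}
    (hg : ∀ C ⊆ T, Convex ℝ C → ∀ x ∈ C, ∀ y ∈ C, ∀ z ∈ C, g x y * g y z = g x z)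
    (hw : walkFold And (LatticeEdge T) a l a) :
    walkFold (· * ·) (fun p q ↦ g (latticePt p) (latticePt q)) a l a = 1 := by
  obtain ⟨R, hR0, hR⟩ := hTb.exists_pos_norm_lt
  set G : ℤ × ℤ → ℤ × ℤ → Γ := fun p q ↦ g (latticePt p) (latticePt q) with hG
  set C : ℤ := ⌈R⌉
  set ht : ℤ × ℤ → ℕ := fun p ↦ (p.1 + p.2 + 2 * C + 1).toNat with hht
  have hbd (r : ℤ × ℤ) (hr : latticePt r ∈ T) : -C ≤ r.1 ∧ -C ≤ r.2 := by
    have h1 := (abs_lt.1 ((Complex.abs_re_le_norm _).trans_lt (hR _ hr))).1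
    have h2 := (abs_lt.1 ((Complex.abs_im_le_norm _).trans_lt (hR _ hr))).1
    have := Int.le_ceil R
    constructor <;> (rify; simp only [latticePt, C] at *; linarith)
  have hmem {p q : ℤ × ℤ} (h : LatticeEdge T p q) : latticePt p ∈ T ∧ latticePt q ∈ T :=
    ⟨h.2 (left_mem_segment ..), h.2 (right_mem_segment ..)⟩
  have hself (x : ℂ) (hx : x ∈ T) : g x x = 1 := by
    simpa using hg {x} (by simpa) (convex_singleton x) x rfl x rfl x rfl
  have hinv (p q : ℤ × ℤ) (h : LatticeEdge T p q) : G p q * G q p = 1 := by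
    rw [← hself _ (hmem h).1]
    exact hg _ h.2 (convex_segment _ _) _ (left_mem_segment ..) _ (right_mem_segment ..)
      _ (left_mem_segment ..)
  suffices H : ∀ n : ℕ, ∀ a l, walkFold And (LatticeEdge T) a l a → ht a + (l.map ht).sum < n →
      walkFold (· * ·) G a l a = 1 from H _ a l hw (Nat.lt_succ_self _)
  intro n
  induction n with
  | zero => intro a l _ h; omega
  | succ n ih =>
  suffices Hmax : ∀ a l, walkFold And (LatticeEdge T) a l a → ht a + (l.map ht).sum < n + 1 →
      (∀ x ∈ l, x.2 < a.2 ∨ x.2 = a.2 ∧ x.1 ≤ a.1) → walkFold (· * ·) G a l a = 1 by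
    intro a l hw hn
    obtain ⟨m, hm, hmax⟩ := exists_lex_max a l
    rcases List.mem_cons.1 hm with rfl | hm
    · exact Hmax m l hw hn fun x hx ↦ hmax x (List.mem_cons_of_mem _ hx)
    · obtain ⟨l₁, l₂, rfl⟩ := List.append_of_mem hm
      have h1 := Hmax m (l₂ ++ a :: l₁)
      simp only [walkFold_append_cons] at h1 hw ⊢
      rw [mul_eq_one_comm]
      refine h1 hw.symm ?_ fun x hx ↦ hmax x ?_
      · simp at hn ⊢; omega
      · simp at hx ⊢; tauto
  intro a l hw hn hmax
  have hpos (p : ℤ × ℤ) (hp : latticePt p ∈ T) : 0 < ht p := by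
    have := hbd p hp
    simp only [hht]; omega
  by_cases hal : a ∈ l
  · obtain ⟨l₁, l₂, rfl⟩ := List.append_of_mem hal
    rw [walkFold_append_cons] at hw ⊢
    have haT : latticePt a ∈ T := (walkFold_and_ends (fun p q h ↦ hmem h) hw.1).1
    have := hpos a haT
    simp at hn
    rw [ih a l₁ hw.1 (by omega), ih a l₂ hw.2 (by omega), one_mul]
  replace hmax : ∀ x ∈ l, x.2 < a.2 ∨ x.2 = a.2 ∧ x.1 < a.1 := by
    intro x hx
    have h1 := hmax x hx
    have h2 : ¬ (x.1 = a.1 ∧ x.2 = a.2) := fun h ↦ hal (Prod.ext h.1 h.2 ▸ hx)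
    omega
  rcases l with - | ⟨u, l⟩
  · exact hself _ (hmem hw).1
  rcases List.eq_nil_or_concat' l with rfl | ⟨l, v, rfl⟩
  · exact hinv _ _ hw.1
  have hw' := hw
  simp only [walkFold, walkFold_append_cons] at hw' ⊢
  obtain ⟨h1, h2, h3⟩ := hw'
  have hapos := hpos a (hmem h1).1
  simp at hn
  by_cases huv : u = v
  · subst huv
    rw [ih u l h2 (by omega), one_mul, hinv _ _ h1]
  have hne := latticeWinding_corner_ne_zero hw hmax huv
  set w : ℤ × ℤ := (a.1 - 1, a.2 - 1) with hwdef
  have hsq : latticeSquare (a.1 - 1) (a.2 - 1) ⊆ T := fun z hz ↦ by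
    by_contra h
    exact hne (latticeWinding_eq_zero hTb hTc hw h hz)
  have hcv := convex_latticeSquare (a.1 - 1) (a.2 - 1)
  have hin (p : ℤ × ℤ) (hp : a.1 - 1 ≤ p.1 ∧ p.1 ≤ a.1 ∧ a.2 - 1 ≤ p.2 ∧ p.2 ≤ a.2) :
      latticePt p ∈ latticeSquare (a.1 - 1) (a.2 - 1) := by
    rw [mem_latticeSquare]
    simp only [latticePt]
    norm_cast
    omega
  have hu := hmax u (by simp)
  have hv := hmax v (by simp)
  have h1' := h1.1
  have h3' := h3.1
  have huS := hin u (by omega)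
  have hvS := hin v (by omega)
  have haS := hin a (by omega)
  have hwS := hin w (by simp only [hwdef]; omega)
  have hne' : ¬ (u.1 = v.1 ∧ u.2 = v.2) := fun h ↦ huv (Prod.ext h.1 h.2)
  have hwu : LatticeEdge T w u :=
    ⟨by simp only [hwdef]; omega, (hcv.segment_subset hwS huS).trans hsq⟩
  have hvw : LatticeEdge T v w :=
    ⟨by simp only [hwdef]; omega, (hcv.segment_subset hvS hwS).trans hsq⟩
  have hmain := ih w (u :: (l ++ [v])) (by
    simp only [walkFold, walkFold_append_cons]; exact ⟨hwu, h2, hvw⟩) (by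
    have : ht w < ht a := by
      have := hbd w (hsq hwS)
      simp only [hht, hwdef] at this ⊢; omega
    simp; omega)
  simp only [walkFold, walkFold_append_cons] at hmain
  have e1 : G a u = G a w * G w u := (hg _ hsq hcv _ haS _ hwS _ huS).symm
  have e2 : G v a = G v w * G w a := (hg _ hsq hcv _ hvS _ hwS _ haS).symm
  have e3 : G a w * G w a = 1 :=
    (hg _ hsq hcv _ haS _ hwS _ haS).trans (hself _ (hsq haS))
  rw [e1, e2]
  calc _ = G a w * (G w u * (walkFold (· * ·) G u l v * G v w)) * G w a := by group
    _ = 1 := by rw [hmain, mul_one, e3]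
end

/-- The product of a local cocycle along a closed chain of points with small steps is trivial. -/
theorem walkFold_chain_eq_one {T : Set ℂ} (hTb : Bornology.IsBounded T)
    (hTc : IsPreconnected Tᶜ) {Γ : Type*} [Group Γ] {g : ℂ → ℂ → Γ}
    (hg : ∀ C ⊆ T, Convex ℝ C → ∀ x ∈ C, ∀ y ∈ C, ∀ z ∈ C, g x y * g y z = g x z)
    {δ : ℝ} (hδ : 0 < δ) {a : ℂ} {l : List ℂ}
    (hw : walkFold And (fun p q ↦ dist q p < δ ∧ Metric.ball p (4 * δ) ⊆ T) a l a) :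
    walkFold (· * ·) g a l a = 1 := by
  set T' : Set ℂ := (fun z : ℂ ↦ δ • z) ⁻¹' T with hT'
  have hTb' : Bornology.IsBounded T' := by
    obtain ⟨R, hR0, hR⟩ := hTb.exists_pos_norm_lt
    refine (Metric.isBounded_ball (x := (0 : ℂ)) (r := R / δ)).subset fun z hz ↦ ?_
    have := hR _ hz
    rw [norm_smul, Real.norm_of_nonneg hδ.le] at this
    rwa [mem_ball_zero_iff, lt_div_iff₀' hδ]
  have hTc' : IsPreconnected T'ᶜ :=
    (Homeomorph.isPreconnected_preimage (Homeomorph.smulOfNeZero δ hδ.ne')).2 hTc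
  have hpre {C : Set ℂ} (h : Convex ℝ C) : Convex ℝ ((fun z : ℂ ↦ δ • z) ⁻¹' C) :=
    h.linear_preimage (δ • LinearMap.id)
  set g' : ℂ → ℂ → Γ := fun x y ↦ g (δ • x) (δ • y) with hg'
  have hcoc : ∀ C ⊆ T', Convex ℝ C → ∀ x ∈ C, ∀ y ∈ C, ∀ z ∈ C, g' x y * g' y z = g' x z := by
    intro C hC hconv x hx y hy z hz
    exact hg ((δ • ·) '' C) (image_subset_iff.2 hC) (hconv.smul δ) _ (mem_image_of_mem _ hx) _
      (mem_image_of_mem _ hy) _ (mem_image_of_mem _ hz)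
  set r : ℂ → ℤ × ℤ := fun z ↦ (⌊z.re / δ⌋, ⌊z.im / δ⌋) with hr
  set ρ : ℤ × ℤ → ℂ := fun p ↦ δ • latticePt p with hρ
  have hfl (x : ℝ) : δ * ⌊x / δ⌋ ≤ x ∧ x < δ * ⌊x / δ⌋ + δ := by
    have h1 := Int.floor_le (x / δ)
    have h2 := Int.lt_floor_add_one (x / δ)
    rw [le_div_iff₀' hδ] at h1
    rw [div_lt_iff₀' hδ] at h2
    exact ⟨h1, by linarith⟩
  have hfl1 (x y : ℝ) (h : |y - x| < δ) : ⌊x / δ⌋ ≤ ⌊y / δ⌋ + 1 ∧ ⌊y / δ⌋ ≤ ⌊x / δ⌋ + 1 := by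
    have h1 := abs_lt.1 h
    have hx := hfl x
    have hy := hfl y
    constructor
    · have : δ * (⌊x / δ⌋ : ℝ) < δ * ((⌊y / δ⌋ : ℝ) + 1 + 1) := by linarith
      have := lt_of_mul_lt_mul_left this hδ.le
      exact Int.lt_add_one_iff.1 (by exact_mod_cast this)
    · have : δ * (⌊y / δ⌋ : ℝ) < δ * ((⌊x / δ⌋ : ℝ) + 1 + 1) := by linarith
      have := lt_of_mul_lt_mul_left this hδ.le
      exact Int.lt_add_one_iff.1 (by exact_mod_cast this)
  have hnear (p z : ℂ) (h1 : |z.re - p.re| < 2 * δ) (h2 : |z.im - p.im| < 2 * δ) :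
      z ∈ Metric.ball p (4 * δ) := by
    rw [mem_ball_iff_norm]
    refine (Complex.norm_le_abs_re_add_abs_im _).trans_lt ?_
    simp only [Complex.sub_re, Complex.sub_im]
    linarith
  have hstep (p q : ℂ) (h : dist q p < δ ∧ Metric.ball p (4 * δ) ⊆ T) :
      ∃ m : ℤ × ℤ, LatticeEdge T' (r p) m ∧ LatticeEdge T' m (r q) ∧
        g p q = g p (ρ (r p)) * (g (ρ (r p)) (ρ m) * g (ρ m) (ρ (r q))) * (g q (ρ (r q)))⁻¹ := by
    obtain ⟨hd, hB⟩ := h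
    rw [dist_eq_norm] at hd
    have hre : |q.re - p.re| < δ := (Complex.abs_re_le_norm (q - p)).trans_lt hd
    have him : |q.im - p.im| < δ := (Complex.abs_im_le_norm (q - p)).trans_lt hd
    have hpm : p ∈ Metric.ball p (4 * δ) := Metric.mem_ball_self (by positivity)
    have fpr := hfl p.re
    have fpi := hfl p.im
    have fqr := hfl q.re
    have fqi := hfl q.im
    have hre' := abs_lt.1 hre
    have him' := abs_lt.1 him
    have hqm : q ∈ Metric.ball p (4 * δ) := hnear _ _ (by linarith) (by linarith)
    have hrp : ρ (r p) ∈ Metric.ball p (4 * δ) := by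
      apply hnear <;> simp only [hρ, hr, latticePt, Complex.smul_re, Complex.smul_im, smul_eq_mul,
        abs_lt] <;> constructor <;> linarith
    have hrq : ρ (r q) ∈ Metric.ball p (4 * δ) := by
      apply hnear <;> simp only [hρ, hr, latticePt, Complex.smul_re, Complex.smul_im, smul_eq_mul,
        abs_lt] <;> constructor <;> linarith
    have hm : ρ ((r q).1, (r p).2) ∈ Metric.ball p (4 * δ) := by
      apply hnear <;> simp only [hρ, hr, latticePt, Complex.smul_re, Complex.smul_im, smul_eq_mul,
        abs_lt] <;> constructor <;> linarith
    have hcv := convex_ball p (4 * δ)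
    have hmul := hg _ hB hcv
    refine ⟨((r q).1, (r p).2), ⟨Or.inr ⟨rfl, hfl1 _ _ hre⟩, ?_⟩,
      ⟨Or.inl ⟨rfl, hfl1 _ _ him⟩, ?_⟩, ?_⟩
    · exact ((hpre hcv).segment_subset hrp hm).trans (preimage_mono hB)
    · exact ((hpre hcv).segment_subset hm hrq).trans (preimage_mono hB)
    · rw [hmul _ hrp _ hm _ hrq, hmul _ hpm _ hrp _ hrq, eq_mul_inv_iff_mul_eq,
        hmul _ hpm _ hqm _ hrq]
  have key (b : ℂ) : ∀ (l : List ℂ) (a : ℂ),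
      walkFold And (fun p q ↦ dist q p < δ ∧ Metric.ball p (4 * δ) ⊆ T) a l b →
      ∃ L, walkFold And (LatticeEdge T') (r a) L (r b) ∧ walkFold (· * ·) g a l b =
        g a (ρ (r a)) * walkFold (· * ·) (fun p q ↦ g' (latticePt p) (latticePt q)) (r a) L (r b) *
          (g b (ρ (r b)))⁻¹ := by
    intro l
    induction l with
    | nil =>
      intro a hw
      obtain ⟨m, h1, h2, h3⟩ := hstep a b hw
      exact ⟨[m], ⟨h1, h2⟩, h3⟩
    | cons x l ih =>
      intro a hw
      obtain ⟨m, h1, h2, h3⟩ := hstep a x hw.1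
      obtain ⟨L, hL, hLe⟩ := ih x hw.2
      refine ⟨m :: r x :: L, ⟨h1, h2, hL⟩, ?_⟩
      simp only [walkFold, hLe, h3]
      group
      rfl
  obtain ⟨L, hL, hLe⟩ := key a l a hw
  rw [hLe, walkFold_lattice_eq_one hTb' hTc' hcoc hL]
  group

section
variable {X : Type*} [TopologicalSpace X] {x₀ : X}

/-- The element of the fundamental group obtained from a path class by closing it up with fixed
path classes from the base point. -/
noncomputable def loopClass (q : ∀ x : X, Path.Homotopic.Quotient x₀ x) {x y : X}
    (p : Path.Homotopic.Quotient x y) : (FundamentalGroup X x₀)ᵐᵒᵖ :=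
  MulOpposite.op (((q x).trans (p.trans (q y).symm) : Path.Homotopic.Quotient x₀ x₀))

theorem loopClass_trans (q : ∀ x : X, Path.Homotopic.Quotient x₀ x) {x y z : X}
    (p : Path.Homotopic.Quotient x y) (p' : Path.Homotopic.Quotient y z) :
    loopClass q (p.trans p') = loopClass q p * loopClass q p' := by
  have h : (((q x).trans (p.trans (q y).symm)).trans ((q y).trans (p'.trans (q z).symm)) :
      Path.Homotopic.Quotient x₀ x₀) = (q x).trans ((p.trans p').trans (q z).symm) := by grind
  exact congrArg MulOpposite.op h.symm

theorem loopClass_cast (q : ∀ x : X, Path.Homotopic.Quotient x₀ x) {x y x' y' : X}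
    (p : Path x y) (hx : x' = x) (hy : y' = y) :
    loopClass q (.mk (p.cast hx hy)) = loopClass q (.mk p) := by
  subst hx hy
  rfl

theorem eq_refl_of_loopClass_eq_one {q : ∀ x : X, Path.Homotopic.Quotient x₀ x}
    {p : Path.Homotopic.Quotient x₀ x₀} (h : loopClass q p = 1) :
    p = Path.Homotopic.Quotient.refl x₀ := by
  have h' : (((q x₀).trans (p.trans (q x₀).symm)) : Path.Homotopic.Quotient x₀ x₀) =
    Path.Homotopic.Quotient.refl x₀ := congrArg MulOpposite.unop h
  calc p = ((q x₀).symm.trans ((q x₀).trans (p.trans (q x₀).symm))).trans (q x₀) := by grind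
    _ = _ := by rw [h']; simp

end

theorem Convex.paths_homotopic {E : Type*} [AddCommGroup E] [Module ℝ E] [TopologicalSpace E]
    [IsTopologicalAddGroup E] [ContinuousSMul ℝ E] {T C : Set E} (hC : Convex ℝ C) (hCT : C ⊆ T)
    {x y : T} (p p' : Path x y) (hp : ∀ t, (p t : E) ∈ C) (hp' : ∀ t, (p' t : E) ∈ C) :
    p.Homotopic p' :=
  ⟨{  toFun := fun s ↦ ⟨AffineMap.lineMap (p s.2 : E) (p' s.2 : E) (s.1 : ℝ),
        hCT (hC.lineMap_mem (hp _) (hp' _) s.1.2)⟩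
      continuous_toFun := by
        simp only [AffineMap.lineMap_apply]
        fun_prop
      map_zero_left := fun t ↦ Subtype.ext (by simp)
      map_one_left := fun t ↦ Subtype.ext (by simp)
      prop' := fun t s hs ↦ Subtype.ext (by
        rcases hs with rfl | rfl <;> simp) }⟩

/-- A bounded path-connected open planar set with connected complement is simply connected. -/
theorem simplyConnectedSpace_of_isPreconnected_compl {T : Set ℂ} (hTo : IsOpen T)
    (hTp : IsConnected T) (hTb : Bornology.IsBounded T) (hTc : IsPreconnected Tᶜ) :
    SimplyConnectedSpace T := by
  have hpc : PathConnectedSpace T :=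
    isPathConnected_iff_pathConnectedSpace.1 (hTo.isConnected_iff_isPathConnected.1 hTp)
  refine simply_connected_iff_loops_nullhomotopic.2 ⟨hpc, fun x₀ γ ↦ ?_⟩
  classical
  let q : ∀ x : T, Path.Homotopic.Quotient x₀ x := fun x ↦
    Path.Homotopic.Quotient.mk (PathConnectedSpace.somePath x₀ x)
  let seg (x y : ℂ) (h : segment ℝ x y ⊆ T) :
      Path (⟨x, h (left_mem_segment ..)⟩ : T) ⟨y, h (right_mem_segment ..)⟩ :=
    { toFun := fun t ↦ ⟨AffineMap.lineMap x y (t : ℝ),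
        h ((convex_segment x y).lineMap_mem (left_mem_segment ..) (right_mem_segment ..) t.2)⟩
      continuous_toFun := by
        simp only [AffineMap.lineMap_apply]
        fun_prop
      source' := by simp
      target' := by simp }
  let g : ℂ → ℂ → (FundamentalGroup T x₀)ᵐᵒᵖ := fun x y ↦
    if h : segment ℝ x y ⊆ T then loopClass q (.mk (seg x y h)) else 1
  have hgp : ∀ C ⊆ T, Convex ℝ C → ∀ (x y : T) (p : Path x y), (∀ t, (p t : ℂ) ∈ C) →
      loopClass q (.mk p) = g x y := by
    intro C hCT hC x y p hp
    have hx : (x : ℂ) ∈ C := by simpa using hp 0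
    have hy : (y : ℂ) ∈ C := by simpa using hp 1
    have hs := hC.segment_subset hx hy
    simp only [g, dif_pos (hs.trans hCT)]
    congr 1
    exact Path.Homotopic.Quotient.eq.2 (hC.paths_homotopic hCT _ _ hp fun t ↦
      hC.lineMap_mem hx hy t.2)
  have hg : ∀ C ⊆ T, Convex ℝ C → ∀ x ∈ C, ∀ y ∈ C, ∀ z ∈ C, g x y * g y z = g x z := by
    intro C hCT hC x hx y hy z hz
    have hxy := (hC.segment_subset hx hy).trans hCT
    have hyz := (hC.segment_subset hy hz).trans hCT
    rw [← hgp C hCT hC ⟨x, hCT hx⟩ ⟨z, hCT hz⟩ ((seg x y hxy).trans (seg y z hyz)),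
      Path.Homotopic.Quotient.mk_trans, loopClass_trans]
    · simp only [g, dif_pos hxy, dif_pos hyz]
    · intro t
      rw [Path.trans_apply]
      split_ifs
      · exact hC.lineMap_mem hx hy ((unitInterval.mul_pos_mem_iff two_pos).2 ⟨t.2.1, by assumption⟩)
      · exact hC.lineMap_mem hy hz (unitInterval.two_mul_sub_one_mem_iff.2 ⟨by linarith, t.2.2⟩)
  set f : unitInterval → ℂ := fun t ↦ γ t with hf
  have hfc : Continuous f := by fun_prop
  obtain ⟨ε, hε, hεT⟩ := (isCompact_range hfc).exists_thickening_subset_open hTo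
    (range_subset_iff.2 fun t ↦ (γ t).2)
  have hball (t : unitInterval) : Metric.ball (f t) (4 * (ε / 4)) ⊆ T := by
    rw [mul_div_cancel₀ _ four_ne_zero]
    exact (Metric.ball_subset_thickening (mem_range_self t) ε).trans hεT
  obtain ⟨t, ht0, htm, ⟨n, htn⟩, ht⟩ := exists_monotone_Icc_subset_open_cover_unitInterval
    (c := fun y : ℂ ↦ f ⁻¹' Metric.ball y (ε / 4 / 2))
    (fun y ↦ Metric.isOpen_ball.preimage hfc)
    (fun s _ ↦ mem_iUnion.2 ⟨f s, Metric.mem_ball_self (by positivity)⟩)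
  have hd (k : ℕ) (s : unitInterval) (hs : s ∈ Icc (t k) (t (k + 1))) :
      dist (f s) (f (t k)) < ε / 4 := by
    obtain ⟨y, hy⟩ := ht k
    have h1 := hy hs
    have h2 := hy (left_mem_Icc.2 (htm k.le_succ))
    simp only [mem_preimage, Metric.mem_ball] at h1 h2
    linarith [dist_triangle_right (f s) (f (t k)) y]
  have hsub (k : ℕ) : loopClass q (.mk (γ.subpath (t k) (t (k + 1)))) =
      g (f (t k)) (f (t (k + 1))) := by
    refine hgp _ (hball (t k)) (convex_ball _ _) _ _ _ fun s ↦ ?_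
    have hs : γ.subpath (t k) (t (k + 1)) s ∈ range (γ.subpath (t k) (t (k + 1))) :=
      mem_range_self s
    rw [Path.range_subpath_of_le _ _ _ (htm k.le_succ)] at hs
    obtain ⟨u, hu, hus⟩ := hs
    rw [← hus, Metric.mem_ball]
    exact (hd k u hu).trans (by linarith)
  have key (k : ℕ) : ∃ l, walkFold And (fun p q ↦ dist q p < ε / 4 ∧
      Metric.ball p (4 * (ε / 4)) ⊆ T) (f (t 0)) l (f (t (k + 1))) ∧
      loopClass q (.mk (γ.subpath (t 0) (t (k + 1)))) =
        walkFold (· * ·) g (f (t 0)) l (f (t (k + 1))) := by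
    have hE (k : ℕ) := And.intro (hd k _ (right_mem_Icc.2 (htm k.le_succ))) (hball (t k))
    induction k with
    | zero => exact ⟨[], hE 0, hsub 0⟩
    | succ k ih =>
      obtain ⟨l, hl, hle⟩ := ih
      refine ⟨l ++ [f (t (k + 1))], ?_, ?_⟩
      · rw [walkFold_append_cons]
        exact ⟨hl, hE (k + 1)⟩
      · rw [walkFold_append_cons, ← hle, walkFold, ← hsub, ← loopClass_trans,
          ← Path.Homotopic.Quotient.mk_trans]
        congr 1
        exact Path.Homotopic.Quotient.eq.2 ⟨(Path.Homotopy.subpathTransSubpath ..).symm⟩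
  obtain ⟨l, hl, hle⟩ := key n
  rw [ht0, htn (n + 1) n.le_succ] at hl hle
  have hf0 : f 0 = x₀ := by simp [hf]
  have hf1 : f 1 = x₀ := by simp [hf]
  rw [hf0, hf1] at hl hle
  rw [walkFold_chain_eq_one hTb hTc hg (by positivity) hl, Path.subpath_zero_one] at hle
  rw [loopClass_cast] at hle
  have := eq_refl_of_loopClass_eq_one hle
  rw [← Path.Homotopic.Quotient.mk_refl] at this
  exact Path.Homotopic.Quotient.eq.1 this

/-- The plane is unicoherent. -/
theorem isPreconnected_inter_of_union_eq_univ {A B : Set ℂ} (hA : IsClosed A) (hB : IsClosed B)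
    (hA' : IsPreconnected A) (hB' : IsPreconnected B) (hAB : A ∪ B = univ) :
    IsPreconnected (A ∩ B) := by
  rw [isPreconnected_closed_iff]
  intro P' Q' hP' hQ' hsub ⟨p, hpAB, hp⟩ ⟨q, hqAB, hq⟩
  by_contra hne
  rw [not_nonempty_iff_eq_empty] at hne
  have hdisj : Disjoint (A ∩ B ∩ P') (A ∩ B ∩ Q') := by
    rw [disjoint_iff_inter_eq_empty, ← hne]
    ext; simp; tauto
  obtain ⟨u, hu0, hu1, -⟩ := exists_continuous_zero_one_of_isClosed
    ((hA.inter hB).inter hP') ((hA.inter hB).inter hQ') hdisj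
  classical
  set h : ℂ → Circle := fun z ↦
    if z ∈ A then Circle.exp (Real.pi * u z) else Circle.exp (-(Real.pi * u z)) with hh
  have hhB : ∀ z ∈ B, h z = Circle.exp (-(Real.pi * u z)) := by
    intro z hz
    by_cases hzA : z ∈ A
    · rcases hsub ⟨hzA, hz⟩ with hP | hQ
      · simp [hh, hu0 ⟨⟨hzA, hz⟩, hP⟩]
      · simp only [hh, if_pos hzA, hu1 ⟨⟨hzA, hz⟩, hQ⟩]
        rw [Circle.exp_eq_exp]
        exact ⟨1, by simp; ring⟩
    · simp [hh, hzA]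
  have hhA : ∀ z ∈ A, h z = Circle.exp (Real.pi * u z) := fun z hz ↦ if_pos hz
  have hcont : Continuous h := by
    rw [← continuousOn_univ, ← hAB]
    refine ContinuousOn.union_of_isClosed ?_ ?_ hA hB
    · exact ContinuousOn.congr (by fun_prop) hhA
    · exact ContinuousOn.congr (by fun_prop) hhB
  obtain ⟨e₀, he₀⟩ := Circle.exp_surjective (h 0)
  obtain ⟨F, ⟨-, hF⟩, -⟩ := Circle.isCoveringMap_exp.existsUnique_continuousMap_lifts
    (⟨h, hcont⟩ : C(ℂ, Circle)) 0 e₀ he₀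
  have hF' (z : ℂ) : Circle.exp (F z) = h z := congrFun hF z
  have hconst {S : Set ℂ} (hS : IsPreconnected S) {v : ℂ → ℝ} (hv : Continuous v)
      (hvS : ∀ z ∈ S, Circle.exp (F z) = Circle.exp (v z)) {z w : ℂ} (hz : z ∈ S) (hw : w ∈ S) :
      F z - v z = F w - v w := by
    refine hS.constant_of_mapsTo (f := fun z ↦ F z - v z)
      (T := (AddSubgroup.zmultiples (2 * Real.pi) : Set ℝ))
      ⟨inferInstanceAs (DiscreteTopology (AddSubgroup.zmultiples (2 * Real.pi)))⟩
      (by fun_prop) (fun z hz ↦ ?_) hz hw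
    obtain ⟨m, hm⟩ := Circle.exp_eq_exp.1 (hvS z hz)
    exact AddSubgroup.mem_zmultiples_iff.2 ⟨m, by simp [hm]⟩
  have e1 := hconst hA' (v := fun z ↦ Real.pi * u z) (by fun_prop)
    (fun z hz ↦ (hF' z).trans (hhA z hz)) hpAB.1 hqAB.1
  have e2 := hconst hB' (v := fun z ↦ -(Real.pi * u z)) (by fun_prop)
    (fun z hz ↦ (hF' z).trans (hhB z hz)) hpAB.2 hqAB.2
  simp only [hu0 ⟨hpAB, hp⟩, hu1 ⟨hqAB, hq⟩, Pi.zero_apply, Pi.one_apply] at e1 e2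
  linarith [Real.pi_pos]

theorem isPreconnected_norm_gt (R : ℝ) : IsPreconnected {z : ℂ | R < ‖z‖} := by
  have : {z : ℂ | R < ‖z‖} =
      (fun p : ℝ × ℝ ↦ (p.1 : ℂ) * Complex.exp (p.2 * Complex.I)) '' (Ioi R ×ˢ univ) := by
    ext z
    constructor
    · intro hz
      exact ⟨(‖z‖, z.arg), ⟨hz, trivial⟩, Complex.norm_mul_exp_arg_mul_I z⟩
    · rintro ⟨⟨r, θ⟩, ⟨hr, -⟩, rfl⟩
      simp only [mem_ofPred_eq, norm_mul, Complex.norm_exp_ofReal_mul_I, mul_one,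
        Complex.norm_real, Real.norm_eq_abs]
      exact (mem_Ioi.1 hr).trans_le (le_abs_self r)
  rw [this]
  exact (isPreconnected_Ioi.prod isPreconnected_univ).image _ (by fun_prop)

theorem isClosed_connectedComponentIn {α : Type*} [TopologicalSpace α] {F : Set α}
    (hF : IsClosed F) (x : α) : IsClosed (connectedComponentIn F x) := by
  by_cases hx : x ∈ F
  · refine closure_subset_iff_isClosed.1 ?_
    exact isPreconnected_connectedComponentIn.closure.subset_connectedComponentIn
      (subset_closure (mem_connectedComponentIn hx))
      (hF.closure_subset_iff.2 (connectedComponentIn_subset F x))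
  · rw [connectedComponentIn_eq_empty hx]
    exact isClosed_empty

/-- The complement of a component of the complement of a connected set is connected. -/
theorem isPreconnected_compl_connectedComponentIn_compl {α : Type*} [TopologicalSpace α]
    [PreconnectedSpace α] {U : Set α} (hUo : IsOpen U) (hU : IsConnected U) {x : α} (hx : x ∉ U) :
    IsPreconnected (connectedComponentIn Uᶜ x)ᶜ := by
  set W := connectedComponentIn Uᶜ x with hW
  have hWc : IsClosed W := isClosed_connectedComponentIn hUo.isClosed_compl x
  have hxW : x ∈ W := mem_connectedComponentIn hx
  have hUW : U ⊆ Wᶜ := subset_compl_comm.1 (connectedComponentIn_subset _ _)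
  -- a relatively clopen piece of `Wᶜ` missing `U` is empty
  have key : ∀ A B : Set α, IsOpen A → IsOpen B → A ∩ B ∩ Wᶜ = ∅ → Wᶜ ⊆ A ∪ B → U ⊆ A →
      Wᶜ ∩ B = ∅ := by
    intro A B hA hB hAB hcov hUA
    by_contra hne
    obtain ⟨b, hbW, hbB⟩ := nonempty_iff_ne_empty.2 hne
    have hSc : IsClosed (W ∪ (Wᶜ ∩ B)) := by
      have : W ∪ (Wᶜ ∩ B) = (Wᶜ ∩ A)ᶜ := by
        ext z
        have h1 : z ∈ A → z ∈ B → z ∈ W := fun h1 h2 ↦ by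
          by_contra h3
          exact hAB.subset ⟨⟨h1, h2⟩, h3⟩
        have h2 : z ∉ W → z ∈ A ∨ z ∈ B := fun h ↦ hcov h
        simp only [mem_union, mem_inter_iff, mem_compl_iff]
        tauto
      rw [this]
      exact (hWc.isOpen_compl.inter hA).isClosed_compl
    have hpiece : ∀ P Q : Set α, IsClosed P → IsClosed Q → W ∪ (Wᶜ ∩ B) ⊆ P ∪ Q →
        (W ∪ (Wᶜ ∩ B)) ∩ (P ∩ Q) = ∅ → W ⊆ P → (W ∪ (Wᶜ ∩ B)) ∩ Q = ∅ := by
      intro P Q hP hQ hcov hPQ hWP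
      have heq : (W ∪ (Wᶜ ∩ B)) ∩ Q = Wᶜ ∩ B ∩ Pᶜ := by
        ext z
        have h1 : z ∈ W ∪ (Wᶜ ∩ B) → z ∈ P → z ∈ Q → False :=
          fun h1 h2 h3 ↦ hPQ.subset ⟨h1, h2, h3⟩
        have h2 := @hcov z
        have h3 := @hWP z
        simp only [mem_union, mem_inter_iff, mem_compl_iff] at h1 h2 ⊢
        tauto
      have hclopen : IsClopen ((W ∪ (Wᶜ ∩ B)) ∩ Q) :=
        ⟨hSc.inter hQ, heq ▸ (hWc.isOpen_compl.inter hB).inter hP.isOpen_compl⟩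
      refine (isClopen_iff.1 hclopen).resolve_right fun huniv ↦ ?_
      exact (heq.subset (huniv ▸ mem_univ x)).1.1 hxW
    have hpre : IsPreconnected (W ∪ (Wᶜ ∩ B)) := by
      rw [isPreconnected_closed_iff]
      intro P Q hP hQ hcov hSP hSQ
      by_contra hPQ
      rw [not_nonempty_iff_eq_empty] at hPQ
      rcases isPreconnected_iff_subset_of_disjoint_closed.1 isPreconnected_connectedComponentIn
        P Q hP hQ (subset_union_left.trans hcov)
        (subset_empty_iff.1 ((inter_subset_inter_left _ subset_union_left).trans hPQ.subset))
        with h | h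
      · exact hSQ.ne_empty (hpiece P Q hP hQ hcov hPQ h)
      · exact hSP.ne_empty (hpiece Q P hQ hP (by rwa [union_comm Q]) (by rwa [inter_comm Q]) h)
    have := hpre.subset_connectedComponentIn (Or.inl hxW) (F := Uᶜ) (by
      rintro z (hz | ⟨hz, hzB⟩) hzU
      · exact hUW hzU hz
      · exact (hAB.subset ⟨⟨hUA hzU, hzB⟩, hz⟩).elim)
    exact hbW (this (Or.inr ⟨hbW, hbB⟩))
  intro A B hA hB hcov ⟨a, haW, haA⟩ ⟨b, hbW, hbB⟩
  by_contra hne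
  rw [not_nonempty_iff_eq_empty] at hne
  have hne' : A ∩ B ∩ Wᶜ = ∅ := by rw [inter_comm]; exact hne
  rcases (isPreconnected_iff_subset_of_disjoint.1 hU.isPreconnected A B hA hB (hUW.trans hcov)
    (by rw [← subset_empty_iff, ← hne]; exact inter_subset_inter_left _ hUW)) with h | h
  · exact (key A B hA hB hne' hcov h).subset ⟨hbW, hbB⟩
  · exact (key B A hB hA (by rwa [inter_comm B A]) (by rwa [union_comm]) h).subset ⟨haW, haA⟩

/-- Filling in the bounded complementary components of a bounded plane domain. -/
theorem exists_simplyConnected_superset {U : Set ℂ} (hUo : IsOpen U) (hU : IsConnected U)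
    (hUb : Bornology.IsBounded U) :
    ∃ T : Set ℂ, U ⊆ T ∧ IsOpen T ∧ IsConnected T ∧ Bornology.IsBounded T ∧
      SimplyConnectedSpace T ∧ frontier T ⊆ frontier U ∧ IsPreconnected (frontier T) := by
  obtain ⟨R, hR⟩ := hUb.subset_closedBall 0
  have hfar : {z : ℂ | R < ‖z‖} ⊆ Uᶜ := fun z hz hzU ↦
    (mem_closedBall_zero_iff.1 (hR hzU)).not_gt hz
  obtain ⟨x, hx⟩ : ∃ x : ℂ, R < ‖x‖ := NormedSpace.exists_lt_norm ℝ ℂ R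
  set W := connectedComponentIn Uᶜ x with hW
  have hWU : W ⊆ Uᶜ := connectedComponentIn_subset _ _
  have hWc : IsClosed W := isClosed_connectedComponentIn hUo.isClosed_compl x
  have hWp : IsPreconnected W := isPreconnected_connectedComponentIn
  have hfarW : {z : ℂ | R < ‖z‖} ⊆ W :=
    (isPreconnected_norm_gt R).subset_connectedComponentIn hx hfar
  have hUW : U ⊆ Wᶜ := subset_compl_comm.1 hWU
  have hTp : IsPreconnected Wᶜ :=
    isPreconnected_compl_connectedComponentIn_compl hUo hU (hfar hx)
  have hTc : IsConnected Wᶜ := ⟨hU.nonempty.mono hUW, hTp⟩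
  have hTb : Bornology.IsBounded Wᶜ := by
    refine (Metric.isBounded_closedBall (x := (0 : ℂ)) (r := R)).subset fun z hz ↦ ?_
    rw [mem_closedBall_zero_iff]
    exact not_lt.1 fun h ↦ hz (hfarW h)
  refine ⟨Wᶜ, hUW, hWc.isOpen_compl, hTc, hTb, ?_, ?_, ?_⟩
  · exact simplyConnectedSpace_of_isPreconnected_compl hWc.isOpen_compl hTc hTb
      (by rwa [compl_compl])
  · intro z hz
    rw [frontier_compl, hWc.frontier_eq] at hz
    rw [hUo.frontier_eq]
    refine ⟨?_, hWU hz.1⟩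
    by_contra hzU
    obtain ⟨r, hr, hball⟩ := Metric.mem_nhds_iff.1 (isClosed_closure.isOpen_compl.mem_nhds hzU)
    refine hz.2 (mem_interior_iff_mem_nhds.2
      (Filter.mem_of_superset (Metric.ball_mem_nhds z hr) ?_))
    have hsub := (convex_ball z r).isPreconnected.subset_connectedComponentIn
      (Metric.mem_ball_self hr) (hball.trans (compl_subset_compl.2 subset_closure))
    rwa [← connectedComponentIn_eq hz.1] at hsub
  · rw [frontier_compl, frontier_eq_closure_inter_closure, hWc.closure_eq]
    refine isPreconnected_inter_of_union_eq_univ hWc isClosed_closure hWp hTp.closure ?_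
    exact eq_univ_of_subset (union_subset_union_right _ subset_closure) (union_compl_self W)

theorem Continuous.frontier_image_subset {α β : Type*} [TopologicalSpace α] [TopologicalSpace β]
    [T2Space β] {g : α → β} (hg : Continuous g) (hgo : IsOpenMap g) {U : Set α} (hU : IsOpen U)
    (hUc : IsCompact (closure U)) : frontier (g '' U) ⊆ g '' frontier U := by
  rw [(hgo U hU).frontier_eq, hU.frontier_eq]
  rintro _ ⟨hz, hzU⟩
  obtain ⟨y, hy, rfl⟩ := closure_minimal (image_mono subset_closure)
    (hUc.image hg).isClosed hz
  exact ⟨y, ⟨hy, fun h ↦ hzU ⟨y, h, rfl⟩⟩, rfl⟩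

theorem IsOpenMap.iterate {α : Type*} [TopologicalSpace α] {g : α → α} (hg : IsOpenMap g) (n : ℕ) :
    IsOpenMap g^[n] := by
  induction n with
  | zero => exact IsOpenMap.id
  | succ n ih => exact ih.comp hg

theorem IsPreconnected.inter_frontier_nonempty {α : Type*} [TopologicalSpace α] {S T : Set α}
    (hS : IsPreconnected S) (hST : (S ∩ T).Nonempty) (hST' : (S ∩ Tᶜ).Nonempty) :
    (S ∩ frontier T).Nonempty := by
  rw [frontier_eq_closure_inter_closure]
  exact isPreconnected_closed_iff.1 hS _ _ isClosed_closure isClosed_closure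
    (fun z _ ↦ (em (z ∈ T)).imp (fun h ↦ subset_closure h) fun h ↦ subset_closure h)
    (hST.mono (inter_subset_inter_right _ subset_closure))
    (hST'.mono (inter_subset_inter_right _ subset_closure))

theorem Differentiable.isOpenMap_of_not_const {f : ℂ → ℂ} (hf : Differentiable ℂ f)
    (hfnc : ¬ ∃ c : ℂ, ∀ z, f z = c) : IsOpenMap f :=
  (AnalyticOnNhd.is_constant_or_isOpenMap fun z _ ↦ hf.analyticAt z).resolve_left hfnc

end

open Set

theorem spidersWeb_of_blowing_up (f : ℂ → ℂ)
    (hf : Differentiable ℂ f) (hfnc : ¬ ∃ c : ℂ, ∀ z, f z = c)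
    (X : Set ℂ) (hfX : f '' X ⊆ X)
    (hXunb : ∀ z ∈ X, ¬ Bornology.IsBounded (connectedComponentIn X z))
    (G : Set ℂ) (hGne : G.Nonempty) (hGbd : Bornology.IsBounded G)
    (hGop : IsOpen G) (hGconn : IsConnected G)
    (hGbdry : frontier G ⊆ X)
    (hblow : ∀ K : Set ℂ, IsCompact K → ∃ N : ℕ, ∀ n ≥ N, K ⊆ f^[n] '' G) :
    SpidersWeb X := by
  have hopen (n : ℕ) : IsOpenMap f^[n] := (hf.isOpenMap_of_not_const hfnc).iterate n
  have hcont (n : ℕ) : Continuous f^[n] := hf.continuous.iterate n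
  have hiter (n : ℕ) : MapsTo f^[n] X X := (mapsTo_iff_image_subset.2 hfX).iterate n
  have hcpt : IsCompact (closure G) := hGbd.isCompact_closure
  have hfront (n : ℕ) : frontier (f^[n] '' G) ⊆ X :=
    ((hcont n).frontier_image_subset (hopen n) hGop hcpt).trans
      ((image_mono hGbdry).trans (hiter n).image_subset)
  have hbdd (n : ℕ) : Bornology.IsBounded (f^[n] '' G) :=
    (hcpt.image (hcont n)).isBounded.subset (image_mono subset_closure)
  have hfill (K : Set ℂ) (hK : Bornology.IsBounded K) : ∃ T : Set ℂ, K ⊆ T ∧ IsOpen T ∧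
      IsConnected T ∧ Bornology.IsBounded T ∧ SimplyConnectedSpace T ∧ frontier T ⊆ X ∧
      IsPreconnected (frontier T) := by
    obtain ⟨N, hN⟩ := hblow (closure K) hK.isCompact_closure
    obtain ⟨T, hT, h1, h2, h3, h4, h5, h6⟩ := exists_simplyConnected_superset
      (hopen N G hGop) (hGconn.image _ (hcont N).continuousOn) (hbdd N)
    exact ⟨T, subset_closure.trans ((hN N le_rfl).trans hT), h1, h2, h3, h4,
      h5.trans (hfront N), h6⟩
  choose! T hKT hTo hTc hTb hTs hTX hTf using hfill
  let A : ℕ → Set ℂ := fun n ↦ Nat.rec ∅ (fun n S ↦ T (S ∪ Metric.closedBall 0 n)) n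
  have hA (n : ℕ) : A (n + 1) = T (A n ∪ Metric.closedBall 0 n) := rfl
  have hAb (n : ℕ) : Bornology.IsBounded (A n ∪ Metric.closedBall 0 n) := by
    refine .union ?_ Metric.isBounded_closedBall
    induction n with
    | zero => exact Bornology.isBounded_empty
    | succ n ih => exact hTb _ (ih.union Metric.isBounded_closedBall)
  have hmono (n : ℕ) : A n ⊆ A (n + 1) := subset_union_left.trans (hKT _ (hAb n))
  have hball (n : ℕ) : Metric.closedBall (0 : ℂ) n ⊆ A (n + 1) :=
    subset_union_right.trans (hKT _ (hAb n))
  constructor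
  · have hXne : X.Nonempty := by
      refine (nonempty_iff_ne_empty.2 fun h ↦ ?_).mono hGbdry
      rcases frontier_eq_empty_iff.1 h with h | h
      · exact hGne.ne_empty h
      · exact NormedSpace.unbounded_univ ℂ ℂ (h ▸ hGbd)
    have hmeet {x : ℂ} (hx : x ∈ X) {n : ℕ} (hxn : x ∈ A (n + 1)) :
        (connectedComponentIn X x ∩ frontier (A (n + 1))).Nonempty := by
      by_contra hne
      refine hXunb x hx ((hTb _ (hAb n)).subset ?_)
      by_contra hsub
      rw [← hA] at hsub
      refine hne (isPreconnected_connectedComponentIn.inter_frontier_nonempty ?_ ?_)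
      · exact ⟨x, mem_connectedComponentIn hx, hxn⟩
      · exact not_subset.1 hsub
    refine ⟨hXne, isPreconnected_of_forall_pair fun x hx y hy ↦ ?_⟩
    obtain ⟨n, hn⟩ := exists_nat_ge (max ‖x‖ ‖y‖)
    have hxn := hball n (mem_closedBall_zero_iff.2 ((le_max_left _ _).trans hn))
    have hyn := hball n (mem_closedBall_zero_iff.2 ((le_max_right _ _).trans hn))
    obtain ⟨p, hpx, hp⟩ := hmeet hx hxn
    obtain ⟨q, hqy, hq⟩ := hmeet hy hyn
    refine ⟨connectedComponentIn X x ∪ frontier (A (n + 1)) ∪ connectedComponentIn X y,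
      union_subset (union_subset (connectedComponentIn_subset _ _) (hTX _ (hAb n)))
        (connectedComponentIn_subset _ _), .inl (.inl (mem_connectedComponentIn hx)),
      .inr (mem_connectedComponentIn hy), ?_⟩
    exact (isPreconnected_connectedComponentIn.union p hpx hp (hTf _ (hAb n))).union q
      (.inr hq) hqy isPreconnected_connectedComponentIn
  · refine ⟨fun n ↦ A (n + 1), fun n ↦ ⟨hTb _ (hAb n), hTo _ (hAb n), hTc _ (hAb n),
      hTs _ (hAb n)⟩, fun n ↦ hTX _ (hAb n), fun n ↦ hmono (n + 1), eq_univ_of_forall fun z ↦ ?_⟩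
    obtain ⟨n, hn⟩ := exists_nat_ge ‖z‖
    exact mem_iUnion.2 ⟨n, hball n (mem_closedBall_zero_iff.2 hn)⟩
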